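/- There exists a torsion-free group Γ containing a normal subgroup L isomorphic to ℤ⁴⁸ of finite index such that L equals its own centralizer in Γ, the quotient G = Γ/L is a finite group of order 64, and every irreducible constituent of the complexified conjugation representation of G on ℂ ⊗_ℤ L has Frobenius–Schur indicator equal to −1. (Equivalently, there exists a 48-dimensional flat Riemannian manifold whose holonomy representation has all of its ℝ-irreducible components of quaternionic type.) -/

import Mathlib

open CategoryTheory

/-- The Frobenius–Schur indicator `ν₂(χ) = (1/|G|) ∑_{g ∈ G} χ(g²)` of a class function
`χ : G → ℂ` on a (finite) group `G`, written with a finite sum over the group. -/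
noncomputable def frobeniusSchurIndicator {G : Type*} [Group G] (χ : G → ℂ) : ℂ :=
  (Nat.card G : ℂ)⁻¹ * ∑ᶠ g : G, χ (g ^ 2)

/-- The complexification `ℂ ⊗_ℤ L` of an integral representation of `G` on the lattice
`L = ℤⁿ`, realized on `ℂⁿ` via matrices. -/
noncomputable def complexify {G : Type} [Group G] {n : ℕ}
    (ρ : Representation ℤ G (Fin n → ℤ)) : Representation ℂ G (Fin n → ℂ) :=
  (Matrix.toLinAlgEquiv' : Matrix (Fin n) (Fin n) ℂ ≃ₐ[ℂ] _).toRingEquiv.toRingHom.toMonoidHom.comp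
    (((Int.castRingHom ℂ).mapMatrix :
        Matrix (Fin n) (Fin n) ℤ →+* Matrix (Fin n) (Fin n) ℂ).toMonoidHom.comp
      ((LinearMap.toMatrixAlgEquiv' :
          ((Fin n → ℤ) →ₗ[ℤ] Fin n → ℤ) ≃ₐ[ℤ] Matrix (Fin n) (Fin n) ℤ)
        |>.toRingEquiv.toRingHom.toMonoidHom.comp ρ))

/-- The data of a `48`-dimensional flat Riemannian manifold (given, via the Bieberbach
theorems, by its torsion-free fundamental group `Γ` together with the translation lattice
`L = ker π ≅ ℤ⁴⁸`, a maximal abelian normal subgroup of finite index, i.e. one equal to its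
own centralizer) whose holonomy group `Q ≅ Γ/L` has order `64` and whose holonomy
representation — the conjugation action of `Q` on `L`, transported to `ℤ⁴⁸` by the
isomorphism `e` — has the property that every irreducible constituent of its
complexification `ℂ ⊗_ℤ L` has Frobenius–Schur indicator `−1` (equivalently, all
`ℝ`-irreducible components of the holonomy representation are of quaternionic type). -/
structure QuaternionicHolonomyFlatManifold : Type 1 where
  /-- the fundamental group -/
  Γ : Type
  /-- the holonomy group -/
  Q : Type
  [grpΓ : Group Γ]
  [grpQ : Group Q]
  /-- `Γ` is torsion-free -/
  torsionFree : ∀ γ : Γ, γ ≠ 1 → ¬ IsOfFinOrder γ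
  /-- the projection of `Γ` onto the holonomy group, with kernel the translation
  lattice `L` -/
  π : Γ →* Q
  surj : Function.Surjective π
  /-- the holonomy group has order `64` -/
  cardQ : Nat.card Q = 64
  /-- the lattice `L = ker π` has finite index in `Γ` -/
  finiteIndex : π.ker.FiniteIndex
  /-- `L` is equal to its own centralizer in `Γ` (maximality) -/
  selfCentralizing : Subgroup.centralizer (π.ker : Set Γ) = π.ker
  /-- `L ≅ ℤ⁴⁸` (written multiplicatively) -/
  e : π.ker ≃* Multiplicative (Fin 48 → ℤ)
  /-- the holonomy representation of `Q` on `ℤ⁴⁸` -/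
  ρ : Representation ℤ Q (Fin 48 → ℤ)
  /-- `ρ` is induced by the conjugation action of `Γ` on `L`, transported by `e` -/
  conj_compat : ∀ (γ : Γ) (l : π.ker),
    ρ (π γ) (Multiplicative.toAdd (e l)) =
      Multiplicative.toAdd (e ⟨γ * ↑l * γ⁻¹, π.normal_ker.conj_mem ↑l l.2 γ⟩)
  /-- every irreducible constituent of `ℂ ⊗_ℤ L` is of quaternionic type -/
  quaternionic : ∀ W : FDRep ℂ Q, Simple W →
    (∃ φ : W ⟶ FDRep.of (complexify ρ), φ ≠ 0) →
    frobeniusSchurIndicator W.character = -1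

namespace QuaternionicHolonomy

/-- The elementary abelian quotient `𝔽₄²`, with the two coordinates written over `𝔽₂`. -/
abbrev Base : Type := (ZMod 2 × ZMod 2) × (ZMod 2 × ZMod 2)

/-- The centre `𝔽₄`, written over `𝔽₂` in the basis `1, ω`. -/
abbrev Centre : Type := ZMod 2 × ZMod 2

/-- Multiplication of `𝔽₄ = 𝔽₂[ω]`, `ω² = ω + 1`. -/
def mulF4 (x y : Centre) : Centre :=
  (x.1 * y.1 + x.2 * y.2, x.1 * y.2 + x.2 * y.1 + x.2 * y.2)

/-- The `𝔽₄`-bilinear form `x x' + x y' + ω y y'`; its diagonal is the norm form of `𝔽₁₆ / 𝔽₄`. -/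
def form (u v : Base) : Centre :=
  mulF4 u.1 v.1 + mulF4 u.1 v.2 + mulF4 (0, 1) (mulF4 u.2 v.2)

lemma form_add_left (u v w : Base) : form (u + v) w = form u w + form v w := by
  ext <;> simp [form, mulF4] <;> ring

lemma form_add_right (u v w : Base) : form u (v + w) = form u v + form u w := by
  ext <;> simp [form, mulF4] <;> ring

@[simp]
lemma form_zero_left (u : Base) : form 0 u = 0 := by
  ext <;> simp [form, mulF4]

@[simp]
lemma form_zero_right (u : Base) : form u 0 = 0 := by
  ext <;> simp [form, mulF4]

lemma form_neg_left (u v : Base) : form (-u) v = -form u v := by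
  ext <;> simp [form, mulF4] <;> ring

lemma form_self_ne_zero : ∀ u : Base, u ≠ 0 → form u u ≠ 0 := by
  decide

/-- The three nonzero functionals on the centre. -/
def functional (i : Fin 3) : Centre →+ ZMod 2 :=
  ![AddMonoidHom.fst _ _, AddMonoidHom.snd _ _, AddMonoidHom.fst _ _ + AddMonoidHom.snd _ _] i

lemma exists_functional_eq_zero_and_eq_one :
    ∀ b : Centre, b ≠ 0 → ∃ i, functional i b = 0 ∧ functional (i + 1) b = 1 := by
  decide

lemma eq_zero_of_functional_eq_zero : ∀ b : Centre, (∀ i, functional i b = 0) → b = 0 := by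
  decide

/-- The nontrivial character `𝔽₂ → {±1}`. -/
def sign (t : ZMod 2) : ℤ := if t = 0 then 1 else -1

@[simp]
lemma sign_zero : sign 0 = 1 := rfl

lemma sign_add : ∀ s t : ZMod 2, sign (s + t) = sign s * sign t := by
  decide

lemma sign_mul_self : ∀ s : ZMod 2, sign s * sign s = 1 := by
  decide

lemma sign_eq_one_iff : ∀ s : ZMod 2, sign s = 1 ↔ s = 0 := by
  decide

lemma cast_sign : ∀ t : ZMod 2, ((sign t : ℤ) : ZMod 2) = 1 := by
  decide

lemma exists_sign_commutator :
    ∀ (i : Fin 3) (u : Base), u ≠ 0 →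
      ∃ v, sign (functional i (form v u - form u v)) = -1 := by
  decide

lemma sum_sign_form_self : ∀ i : Fin 3, ∑ u : Base, sign (functional i (form u u)) = -4 := by
  decide

/-- The central extension of `𝔽₄²` by `𝔽₄` with cocycle `form`: a Sylow 2-subgroup of
`PSU(3, 4)`. -/
@[ext]
structure Hol where
  /-- the image in the elementary abelian quotient -/
  base : Base
  /-- the central coordinate -/
  centre : Centre

namespace Hol

instance : Mul Hol := ⟨fun g h => ⟨g.base + h.base, g.centre + h.centre + form g.base h.base⟩⟩
instance : One Hol := ⟨⟨0, 0⟩⟩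
instance : Inv Hol := ⟨fun g => ⟨-g.base, -g.centre + form g.base g.base⟩⟩

@[simp] lemma mul_base (g h : Hol) : (g * h).base = g.base + h.base := rfl
@[simp] lemma mul_centre (g h : Hol) :
    (g * h).centre = g.centre + h.centre + form g.base h.base := rfl
@[simp] lemma one_base : (1 : Hol).base = 0 := rfl
@[simp] lemma one_centre : (1 : Hol).centre = 0 := rfl
@[simp] lemma inv_base (g : Hol) : g⁻¹.base = -g.base := rfl
@[simp] lemma inv_centre (g : Hol) : g⁻¹.centre = -g.centre + form g.base g.base := rfl

instance : Group Hol :=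
  Group.ofLeftAxioms
    (fun g h k => by
      apply Hol.ext
      · simp [add_assoc]
      · simp only [mul_centre, mul_base, form_add_left, form_add_right]
        abel)
    (fun g => by apply Hol.ext <;> simp)
    (fun g => by
      apply Hol.ext
      · simp
      · simp only [mul_centre, inv_base, inv_centre, form_neg_left, one_centre]
        abel)

/-- The underlying set of `Hol` is a product. -/
def equivProd : Hol ≃ Base × Centre where
  toFun g := (g.base, g.centre)
  invFun p := ⟨p.1, p.2⟩
  left_inv _ := rfl
  right_inv _ := rfl

instance : Fintype Hol := Fintype.ofEquiv _ equivProd.symm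

lemma card : Fintype.card Hol = 64 := by
  rw [Fintype.card_congr equivProd]
  simp

lemma sum_eq {M : Type*} [AddCommMonoid M] (F : Hol → M) :
    ∑ g, F g = ∑ u : Base, ∑ b : Centre, F ⟨u, b⟩ := by
  rw [← Fintype.sum_prod_type', ← equivProd.symm.sum_comp]
  rfl

/-- The inclusion of the centre. -/
def ofCentre (b : Centre) : Hol := ⟨0, b⟩

lemma sq_eq (g : Hol) : g ^ 2 = ofCentre (form g.base g.base) := by
  have h : ∀ x : ZMod 2, x + x = 0 := by decide
  rw [pow_two]
  apply Hol.ext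
  · ext <;> simp [ofCentre, h]
  · ext <;> simp [ofCentre, h]

lemma ofCentre_mul_comm (b : Centre) (g : Hol) : ofCentre b * g = g * ofCentre b := by
  apply Hol.ext <;> simp [ofCentre, add_comm]

lemma conj_eq (g h : Hol) :
    h * g * h⁻¹ = ofCentre (form h.base g.base - form g.base h.base) * g := by
  rw [mul_inv_eq_iff_eq_mul]
  apply Hol.ext
  · simp [ofCentre, add_comm]
  · simp only [ofCentre, mul_centre, mul_base, form_zero_left, add_zero, zero_add]
    abel

lemma eq_ofCentre {g : Hol} (h : g.base = 0) : g = ofCentre g.centre := Hol.ext h rfl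

end Hol

open Hol

/-- The index set of the signed permutation module: three characters of the centre, each induced
to `Hol`. -/
abbrev Index : Type := Fin 3 × Base

/-- The value of the cocycle `x ↦ centre + form x base` attached to `g`, on the index `p`. -/
def shift (g : Hol) (p : Index) : Centre := g.centre + form p.2 g.base

lemma shift_mul (g h : Hol) (p : Index) :
    shift (g * h) p = shift g p + shift h (p.1, p.2 + g.base) := by
  simp only [shift, mul_centre, mul_base, form_add_left, form_add_right]
  abel

/-- The sum of the three representations induced from the nontrivial characters of the centre. -/
def act : Representation ℤ Hol (Index → ℤ) where
  toFun g :=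
    { toFun := fun f p => sign (functional p.1 (shift g p)) * f (p.1, p.2 + g.base)
      map_add' := fun f f' => by
        ext p
        simp [mul_add]
      map_smul' := fun c f => by
        ext p
        simp [mul_left_comm] }
  map_one' := by
    ext f p
    simp [shift]
  map_mul' g h := by
    ext f p
    simp [shift_mul, sign_add, mul_assoc, add_assoc]

lemma act_apply (g : Hol) (f : Index → ℤ) (p : Index) :
    act g f p = sign (functional p.1 (shift g p)) * f (p.1, p.2 + g.base) := rfl

lemma act_ofCentre (b : Centre) (f : Index → ℤ) (p : Index) :
    act (ofCentre b) f p = sign (functional p.1 b) * f p := by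
  simp [act_apply, shift, ofCentre]

lemma eq_one_of_act_eq {g : Hol} (h : ∀ f, act g f = f) : g = 1 := by
  have hbase : g.base = 0 := by
    by_contra hne
    have := congrFun (h (Pi.single (0, 0) 1)) (0, 0)
    simp [act_apply, hne] at this
  rw [eq_ofCentre hbase] at h ⊢
  have hcentre : g.centre = 0 := by
    refine eq_zero_of_functional_eq_zero _ fun i => ?_
    have := congrFun (h fun _ => 1) (i, 0)
    rw [act_ofCentre, mul_one] at this
    exact (sign_eq_one_iff _).1 this
  rw [hcentre]
  rfl

/-- The crossed homomorphism `Hol → 𝔽₂^Index` defining the extension. -/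
def parity (g : Hol) (p : Index) : ZMod 2 := functional (p.1 + 1) (shift g p)

lemma parity_mul (g h : Hol) (p : Index) :
    parity (g * h) p = parity g p + parity h (p.1, p.2 + g.base) := by
  simp [parity, shift_mul]

lemma parity_one (p : Index) : parity 1 p = 0 := by
  simp [parity, shift]

lemma cast_act (g : Hol) (f : Index → ℤ) (p : Index) :
    ((act g f p : ℤ) : ZMod 2) = f (p.1, p.2 + g.base) := by
  simp [act_apply, cast_sign]

/-- The fundamental group: affine maps with linear part `act g` and translation part in
`½ ℤ^Index` (here doubled) prescribed modulo `ℤ^Index` by `parity g`. -/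
@[ext]
structure Fund where
  /-- the linear part -/
  hol : Hol
  /-- twice the translation part -/
  trans : Index → ℤ
  /-- the translation part is prescribed modulo the lattice -/
  cast_trans : ∀ p, (trans p : ZMod 2) = parity hol p

namespace Fund

instance : Mul Fund :=
  ⟨fun x y => ⟨x.hol * y.hol, x.trans + act x.hol y.trans, fun p => by
    rw [Pi.add_apply, Int.cast_add, cast_act, x.cast_trans, y.cast_trans, parity_mul]⟩⟩

instance : One Fund := ⟨⟨1, 0, fun p => by simp [parity_one]⟩⟩

instance : Inv Fund :=
  ⟨fun x => ⟨x.hol⁻¹, -act x.hol⁻¹ x.trans, fun p => by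
    have h := parity_mul x.hol⁻¹ x.hol p
    rw [inv_mul_cancel, parity_one] at h
    rw [Pi.neg_apply, Int.cast_neg, cast_act, x.cast_trans]
    exact (eq_neg_of_add_eq_zero_left h.symm).symm⟩⟩

@[simp] lemma mul_hol (x y : Fund) : (x * y).hol = x.hol * y.hol := rfl
@[simp] lemma mul_trans (x y : Fund) : (x * y).trans = x.trans + act x.hol y.trans := rfl
@[simp] lemma one_hol : (1 : Fund).hol = 1 := rfl
@[simp] lemma one_trans : (1 : Fund).trans = 0 := rfl
@[simp] lemma inv_hol (x : Fund) : x⁻¹.hol = x.hol⁻¹ := rfl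
@[simp] lemma inv_trans (x : Fund) : x⁻¹.trans = -act x.hol⁻¹ x.trans := rfl

instance : Group Fund :=
  Group.ofLeftAxioms
    (fun x y z => by
      apply Fund.ext
      · simp [mul_assoc]
      · simp [add_assoc])
    (fun x => by apply Fund.ext <;> simp)
    (fun x => by apply Fund.ext <;> simp)

lemma pow_trans_apply {x : Fund} {p : Index} (h : ∀ f, act x.hol f p = f p) (n : ℕ) :
    (x ^ n).trans p = n * x.trans p := by
  induction n with
  | zero => simp
  | succ n ih =>
    rw [pow_succ', mul_trans, Pi.add_apply, h, ih]
    push_cast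
    ring

lemma trans_apply_eq_zero {x : Fund} (hx : IsOfFinOrder x) {p : Index}
    (h : ∀ f, act x.hol f p = f p) : x.trans p = 0 := by
  obtain ⟨n, hn, hxn⟩ := isOfFinOrder_iff_pow_eq_one.1 hx
  have := pow_trans_apply h n
  rw [hxn, one_trans, Pi.zero_apply] at this
  have hn' : (n : ℤ) ≠ 0 := by exact_mod_cast hn.ne'
  exact (mul_eq_zero.1 this.symm).resolve_left hn'

lemma centre_eq_zero {x : Fund} (hx : IsOfFinOrder x) {b : Centre} (hb : x.hol = ofCentre b) :
    b = 0 := by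
  by_contra hne
  obtain ⟨i, h0, h1⟩ := exists_functional_eq_zero_and_eq_one b hne
  have htrans : x.trans (i, 0) = 0 := by
    refine trans_apply_eq_zero hx fun f => ?_
    rw [hb, act_ofCentre, h0, sign_zero, one_mul]
  have hpar := x.cast_trans (i, 0)
  rw [htrans, hb] at hpar
  simp [parity, shift, ofCentre, h1] at hpar

lemma eq_one_of_isOfFinOrder {x : Fund} (hx : IsOfFinOrder x) : x = 1 := by
  have hbase : x.hol.base = 0 := by
    by_contra hne
    refine form_self_ne_zero _ hne (centre_eq_zero (x := x ^ 2) hx.pow ?_)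
    rw [pow_two, mul_hol, ← pow_two, sq_eq]
  have hhol : x.hol = 1 := by
    have h := eq_ofCentre hbase
    rw [centre_eq_zero hx h] at h
    exact h
  apply Fund.ext
  · exact hhol
  · ext p
    exact trans_apply_eq_zero hx fun f => by rw [hhol]; simp

/-- The projection of the fundamental group onto the holonomy group. -/
def toHol : Fund →* Hol where
  toFun := hol
  map_one' := rfl
  map_mul' _ _ := rfl

@[simp] lemma toHol_apply (x : Fund) : toHol x = x.hol := rfl

lemma toHol_surjective : Function.Surjective toHol := fun g =>
  ⟨⟨g, fun p => (parity g p).val, fun p => by simp⟩, rfl⟩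

/-- The pure translation by `f`. -/
def translation (f : Index → ℤ) : Fund := ⟨1, fun p => 2 * f p, fun p => by
  have h : (2 : ZMod 2) = 0 := rfl
  simp [parity_one, h]⟩

lemma translation_mem (f : Index → ℤ) : translation f ∈ toHol.ker := rfl

lemma hol_of_mem_ker {x : Fund} (hx : x ∈ toHol.ker) : x.hol = 1 := hx

lemma two_mul_div_two (x : toHol.ker) (p : Index) :
    2 * ((x : Fund).trans p / 2) = (x : Fund).trans p := by
  have h := (x : Fund).cast_trans p
  rw [hol_of_mem_ker x.2, parity_one, ZMod.intCast_zmod_eq_zero_iff_dvd] at h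
  exact Int.mul_ediv_cancel' h

lemma centralizer_ker : Subgroup.centralizer (toHol.ker : Set Fund) = toHol.ker := by
  ext x
  rw [Subgroup.mem_centralizer_iff]
  constructor
  · intro h
    refine eq_one_of_act_eq (g := x.hol) fun f => ?_
    have hcomm := congrArg trans (h _ (translation_mem f))
    ext p
    have hp := congrFun hcomm p
    have htwo : (translation f).trans = (2 : ℤ) • f := rfl
    have hone : (translation f).hol = 1 := rfl
    simp only [mul_trans, htwo, hone, map_one, map_smul, Module.End.one_apply, Pi.add_apply,
      Pi.smul_apply, smul_eq_mul] at hp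
    linarith
  · intro hx y hy
    have hx' := hol_of_mem_ker hx
    have hy' := hol_of_mem_ker hy
    apply Fund.ext
    · simp [hx', hy']
    · simp [hx', hy', add_comm]

end Fund

open Fund

/-- An enumeration of the index set. -/
noncomputable def enum : Fin 48 ≃ Index :=
  Fintype.equivOfCardEq (by simp)

/-- The holonomy representation `act`, transported to `ℤ⁴⁸`. -/
noncomputable def rep : Representation ℤ Hol (Fin 48 → ℤ) where
  toFun g := (LinearMap.funLeft ℤ ℤ enum).comp ((act g).comp (LinearMap.funLeft ℤ ℤ enum.symm))
  map_one' := by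
    ext f j
    simp [LinearMap.funLeft_apply]
  map_mul' g h := by
    ext f j
    simp [act_apply, LinearMap.funLeft_apply, add_assoc]

lemma rep_apply (g : Hol) (f : Fin 48 → ℤ) (j : Fin 48) :
    rep g f j = act g (f ∘ enum.symm) (enum j) := rfl

/-- The translation lattice is `ℤ⁴⁸`. -/
noncomputable def latticeEquiv : toHol.ker ≃* Multiplicative (Fin 48 → ℤ) where
  toFun x := Multiplicative.ofAdd fun j => (x : Fund).trans (enum j) / 2
  invFun f := ⟨translation (Multiplicative.toAdd f ∘ enum.symm), translation_mem _⟩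
  left_inv x := by
    apply Subtype.ext
    apply Fund.ext
    · exact (hol_of_mem_ker x.2).symm
    · ext p
      simpa [translation] using two_mul_div_two x p
  right_inv f := by
    apply Multiplicative.toAdd.injective
    ext j
    simp [translation]
  map_mul' x y := by
    apply Multiplicative.toAdd.injective
    ext j
    have hxy := two_mul_div_two (x * y) (enum j)
    have hx := two_mul_div_two x (enum j)
    have hy := two_mul_div_two y (enum j)
    have h : ((x * y : toHol.ker) : Fund).trans (enum j) =
        (x : Fund).trans (enum j) + (y : Fund).trans (enum j) := by
      simp [hol_of_mem_ker x.2]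
    simp only [toAdd_ofAdd, toAdd_mul, Pi.add_apply]
    linarith

lemma two_mul_latticeEquiv (x : toHol.ker) (j : Fin 48) :
    2 * Multiplicative.toAdd (latticeEquiv x) j = (x : Fund).trans (enum j) :=
  two_mul_div_two x (enum j)

lemma rep_latticeEquiv (x : Fund) (l l' : toHol.ker) (h : (l' : Fund) = x * ↑l * x⁻¹) :
    rep (toHol x) (Multiplicative.toAdd (latticeEquiv l)) =
      Multiplicative.toAdd (latticeEquiv l') := by
  ext j
  have hl : (l : Fund).trans = (2 : ℤ) • (Multiplicative.toAdd (latticeEquiv l) ∘ enum.symm) := by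
    ext p
    have := two_mul_latticeEquiv l (enum.symm p)
    rw [enum.apply_symm_apply] at this
    exact this.symm
  have hcancel : act x.hol (act x.hol⁻¹ x.trans) = x.trans := by
    rw [← Module.End.mul_apply, ← map_mul, mul_inv_cancel, map_one, Module.End.one_apply]
  have hconj : (x * ↑l * x⁻¹).trans = act x.hol (l : Fund).trans := by
    simp [hol_of_mem_ker l.2, hcancel]
  apply mul_left_cancel₀ (two_ne_zero (α := ℤ))
  rw [two_mul_latticeEquiv, h, hconj, hl, map_smul, rep_apply]
  rfl

lemma complexify_ofCentre (b : Centre) (v : Fin 48 → ℂ) (j : Fin 48) :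
    complexify rep (ofCentre b) v j = (sign (functional (enum j).1 b) : ℂ) * v j := by
  have hrep : LinearMap.toMatrix' (rep (ofCentre b)) =
      Matrix.diagonal fun j => sign (functional (enum j).1 b) := by
    ext i k
    rw [LinearMap.toMatrix'_apply, rep_apply, act_ofCentre]
    simp [Matrix.diagonal_apply, Pi.single_apply]
  change ((LinearMap.toMatrix' (rep (ofCentre b))).map (Int.castRingHom ℂ)).mulVec v j = _
  rw [hrep, Matrix.diagonal_map (map_zero _), Matrix.mulVec_diagonal]
  simp

/-- **Schur's lemma**: central elements act by scalars on simple representations. -/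
lemma exists_smul_of_central {G : Type} [Group G] (W : FDRep ℂ G) [Simple W] {z : G}
    (hz : ∀ g, z * g = g * z) : ∃ c : ℂ, ∀ w : W, W.ρ z w = c • w := by
  let f : W ⟶ W :=
    { hom := Action.ρ W z
      comm := fun g => by
        change Action.ρ W z * Action.ρ W g = Action.ρ W g * Action.ρ W z
        rw [← map_mul, ← map_mul, hz] }
  obtain ⟨c, hc⟩ := endomorphism_simple_eq_smul_id ℂ f
  refine ⟨c, fun w => ?_⟩
  have h := congrArg (fun k : W ⟶ W => k.hom.hom.hom w) hc
  exact h.symm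

section Constituents

variable {W : FDRep ℂ Hol}

/-- The property that the centre acts on `W` through the `i`-th nontrivial character. -/
def HasCentralCharacter (W : FDRep ℂ Hol) (i : Fin 3) : Prop :=
  ∀ b, W.ρ (ofCentre b) = (sign (functional i b) : ℂ) • LinearMap.id

lemma exists_hasCentralCharacter [Simple W] {φ : W ⟶ FDRep.of (complexify rep)} (hφ : φ ≠ 0) :
    ∃ i, HasCentralCharacter W i := by
  let f : W →ₗ[ℂ] (Fin 48 → ℂ) := φ.hom.hom.hom
  have hf : ∀ g w, f (W.ρ g w) = complexify rep g (f w) := fun g w =>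
    congrArg (fun k => k.hom.hom w) (φ.comm g)
  obtain ⟨w, j, hw⟩ : ∃ w j, f w j ≠ 0 := by
    by_contra! h
    refine hφ (Action.Hom.ext (FGModuleCat.hom_ext ?_))
    ext w j
    exact h w j
  refine ⟨(enum j).1, fun b => ?_⟩
  obtain ⟨c, hc⟩ := exists_smul_of_central W (ofCentre_mul_comm b)
  have h := congrFun (hf (ofCentre b) w) j
  rw [hc, map_smul, complexify_ofCentre, Pi.smul_apply, smul_eq_mul] at h
  rw [← mul_right_cancel₀ hw h]
  ext v
  exact hc v

namespace HasCentralCharacter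

variable {i : Fin 3}

lemma character_ofCentre_mul (hW : HasCentralCharacter W i) (b : Centre) (g : Hol) :
    W.character (ofCentre b * g) = (sign (functional i b) : ℂ) * W.character g := by
  rw [FDRep.character, map_mul, hW b, smul_mul_assoc, map_smul, smul_eq_mul]
  rfl

lemma character_ofCentre (hW : HasCentralCharacter W i) (b : Centre) :
    W.character (ofCentre b) = (sign (functional i b) : ℂ) * Module.finrank ℂ W := by
  rw [← mul_one (ofCentre b), hW.character_ofCentre_mul, FDRep.char_one]

lemma character_eq_zero (hW : HasCentralCharacter W i) {g : Hol} (hg : g.base ≠ 0) :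
    W.character g = 0 := by
  obtain ⟨v, hv⟩ := exists_sign_commutator i g.base hg
  have h := FDRep.char_conj W g ⟨v, 0⟩
  rw [conj_eq, hW.character_ofCentre_mul, hv] at h
  push_cast at h
  linear_combination (-1 / 2 : ℂ) * h

lemma finrank_eq_four [Simple W] (hW : HasCentralCharacter W i) : Module.finrank ℂ W = 4 := by
  have : Invertible (Nat.card Hol : ℂ) := invertibleOfNonzero (by simp [Hol.card])
  have h := FDRep.char_orthonormal W W
  rw [if_pos ⟨Iso.refl W⟩, Hol.sum_eq, Fintype.sum_eq_single 0] at h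
  · have hterm : ∀ b : Centre, W.character ⟨0, b⟩ * W.character (⟨0, b⟩ : Hol)⁻¹ =
        (Module.finrank ℂ W : ℂ) ^ 2 := fun b => by
      have hinv : (⟨0, b⟩ : Hol)⁻¹ = ofCentre b := by
        have hneg : ∀ b : Centre, -b = b := by decide
        apply Hol.ext <;> simp [ofCentre, hneg]
      have hsq : (sign (functional i b) : ℂ) * sign (functional i b) = 1 := by
        exact_mod_cast sign_mul_self _
      have hb := hW.character_ofCentre b
      rw [hinv]
      change W.character (ofCentre b) * _ = _
      rw [hb]
      linear_combination (Module.finrank ℂ W : ℂ) ^ 2 * hsq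
    simp only [hterm, Nat.card_eq_fintype_card, Hol.card] at h
    simp only [Finset.sum_const, Finset.card_univ, Fintype.card_prod, ZMod.card, nsmul_eq_mul] at h
    have h4 : (Module.finrank ℂ W : ℂ) ^ 2 = (4 : ℕ) ^ 2 := by
      push_cast at h ⊢
      linear_combination 16 * h
    exact (Nat.pow_left_injective two_ne_zero) (by exact_mod_cast h4)
  · intro u hu
    exact Finset.sum_eq_zero fun b _ => by
      rw [hW.character_eq_zero (g := ⟨u, b⟩) hu, zero_mul]

lemma frobeniusSchurIndicator_eq [Simple W] (hW : HasCentralCharacter W i) :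
    frobeniusSchurIndicator W.character = -1 := by
  have hsum : ∑ u : Base, (sign (functional i (form u u)) : ℂ) = -4 := by
    exact_mod_cast sum_sign_form_self i
  rw [frobeniusSchurIndicator, finsum_eq_sum_of_fintype, Hol.sum_eq]
  simp only [sq_eq, hW.character_ofCentre, hW.finrank_eq_four, Finset.sum_const, Finset.card_univ,
    Fintype.card_prod, ZMod.card, nsmul_eq_mul,
    Nat.card_eq_fintype_card, Hol.card]
  rw [← Finset.mul_sum, ← Finset.sum_mul, hsum]
  norm_num

end HasCentralCharacter

end Constituents

end QuaternionicHolonomy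

/-- There exists a (48-dimensional) flat Riemannian manifold whose holonomy representation
has all of its `ℝ`-irreducible components of quaternionic type: there is a torsion-free
group `Γ` with a normal subgroup `L ≅ ℤ⁴⁸` of finite index equal to its own centralizer,
such that the quotient `G = Γ/L` has order `64` and every irreducible constituent of the
complexified conjugation representation of `G` on `ℂ ⊗_ℤ L` has Frobenius–Schur indicator
`−1`. -/
theorem exists_quaternionic_holonomy_flat_manifold :
    Nonempty QuaternionicHolonomyFlatManifold := by
  exact ⟨{
    Γ := QuaternionicHolonomy.Fund
    Q := QuaternionicHolonomy.Hol
    torsionFree := fun _ hne hfin =>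
      hne (QuaternionicHolonomy.Fund.eq_one_of_isOfFinOrder hfin)
    π := QuaternionicHolonomy.Fund.toHol
    surj := QuaternionicHolonomy.Fund.toHol_surjective
    cardQ := by rw [Nat.card_eq_fintype_card, QuaternionicHolonomy.Hol.card]
    finiteIndex := Subgroup.finiteIndex_ker _
    selfCentralizing := QuaternionicHolonomy.Fund.centralizer_ker
    e := QuaternionicHolonomy.latticeEquiv
    ρ := QuaternionicHolonomy.rep
    conj_compat := fun x l => QuaternionicHolonomy.rep_latticeEquiv x l _ rfl
    quaternionic := fun W _ ⟨_, hφ⟩ => by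
      obtain ⟨i, hi⟩ := QuaternionicHolonomy.exists_hasCentralCharacter hφ
      exact hi.frobeniusSchurIndicator_eq }⟩
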